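/- arXiv:1406.6748 — 2 statements merged into one kernel-verified Lean document; each statement's English description precedes it below -/
import Mathlib

section
/- Let q be a prime power and let C ⊆ F_q^n be a projective linear code with exactly two nonzero weights w_1 ≠ w_2, i.e., every nonzero codeword has Hamming weight w_1 or w_2 and both weights occur. Let Γ(C) be the simple graph whose vertex set is C, with two distinct codewords u, v adjacent if and only if the Hamming weight of u − v equals w_1. Then Γ(C) is a strongly regular graph: there exist integers d, λ, μ such that Γ(C) is strongly regular with parameters (|C|, d, λ, μ). -/
section ZeroCount

variable {F V ι : Type*} [Field F] [AddCommGroup V] [Module F V]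

lemma exists_apply_eq_zero_and_apply_eq_of_linearIndependent_pair {f g : V →ₗ[F] F}
    (h : LinearIndependent F ![f, g]) (a : F) : ∃ t, f t = 0 ∧ g t = a := by
  have hker : ¬ LinearMap.ker f ≤ LinearMap.ker g := by
    intro hle
    have hmem : g ∈ Submodule.span F (Set.range fun _ : Unit ↦ f) :=
      mem_span_of_iInf_ker_le_ker (by simpa using hle)
    rw [Set.range_const, Submodule.mem_span_singleton] at hmem
    obtain ⟨b, hb⟩ := hmem
    exact (LinearIndependent.pair_iff' (h.ne_zero 0)).1 h b hb
  obtain ⟨t, hft, hgt⟩ := SetLike.not_le_iff_exists.1 hker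
  rw [LinearMap.mem_ker] at hft hgt
  exact ⟨(a / g t) • t, by simp [hft], by simp [hgt]⟩

lemma card_ker_mul_card [Fintype F] [Fintype V] {f : V →ₗ[F] F} (hf : f ≠ 0) :
    Nat.card (LinearMap.ker f) * Fintype.card F = Fintype.card V := by
  have hsurj : Function.Surjective f := LinearMap.surjective hf
  rw [← Nat.card_eq_fintype_card, ← Nat.card_eq_fintype_card,
    Submodule.card_eq_card_quotient_mul_card (LinearMap.ker f),
    Nat.card_congr (f.quotKerEquivOfSurjective hsurj).toEquiv]

open scoped Classical in
/-- The number of functionals of a finite family that vanish at a vector. -/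
noncomputable def zeroCount [Fintype ι] (φ : ι → V →ₗ[F] F) (x : V) : ℤ :=
  ∑ i, if φ i x = 0 then 1 else 0

open scoped Classical in
lemma exists_sum_zeroCount_mul_zeroCount_sub [Fintype F] [Fintype V] [Fintype ι]
    (φ : ι → V →ₗ[F] F) (hnz : ∀ i, φ i ≠ 0)
    (hpair : ∀ i j, i ≠ j → LinearIndependent F ![φ i, φ j]) :
    ∃ c k : ℤ, ∀ v, ∑ x, zeroCount φ x * zeroCount φ (v - x) = c + k * zeroCount φ v := by
  let p : ι → ι → V → ℤ := fun i j v ↦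
    ∑ x, (if φ i x = 0 then 1 else 0) * (if φ j (v - x) = 0 then 1 else 0)
  have hoff (i j : ι) (hij : i ≠ j) (v : V) : p i j v = p i j 0 := by
    obtain ⟨t, hit, hjt⟩ :=
      exists_apply_eq_zero_and_apply_eq_of_linearIndependent_pair (hpair i j hij) (φ j v)
    refine Fintype.sum_equiv (Equiv.subRight t) _ _ fun x ↦ ?_
    simp [hit, hjt, sub_sub_eq_add_sub]
  have hdiag (i : ι) (v : V) : p i i v =
      (Fintype.card V / Fintype.card F : ℕ) * if φ i v = 0 then 1 else 0 := by
    have hcard : Fintype.card V / Fintype.card F = Nat.card (LinearMap.ker (φ i)) := by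
      rw [← card_ker_mul_card (hnz i), Nat.mul_div_cancel _ Fintype.card_pos]
    rw [hcard]
    by_cases hv : φ i v = 0
    · simp [p, hv, Nat.card_eq_fintype_card, Fintype.card_subtype, ← ite_and]
    · simp only [p, hv, if_false, mul_zero]
      refine Finset.sum_eq_zero fun x _ ↦ ?_
      by_cases hx : φ i x = 0 <;> simp [hx, hv]
  refine ⟨∑ i, ∑ j, if i = j then 0 else p i j 0,
    (Fintype.card V / Fintype.card F : ℕ), fun v ↦ ?_⟩
  calc
    ∑ x, zeroCount φ x * zeroCount φ (v - x) = ∑ i, ∑ j, p i j v := by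
      simp only [zeroCount, p, Finset.sum_mul_sum]
      rw [Finset.sum_comm]
      exact Finset.sum_congr rfl fun i _ ↦ Finset.sum_comm
    _ = ∑ i, ∑ j, ((if i = j then 0 else p i j 0) + if i = j then p i i v else 0) := by
      refine Finset.sum_congr rfl fun i _ ↦ Finset.sum_congr rfl fun j _ ↦ ?_
      by_cases hij : i = j
      · subst hij; simp
      · simp [hij, hoff i j hij v]
    _ = _ := by
      simp only [Finset.sum_add_distrib, Finset.sum_ite_eq, Finset.mem_univ, if_true, hdiag,
        zeroCount, Finset.mul_sum]

/-- If the self-convolution of `z` is an affine function of `z` and `A` is an affine function of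
`z` away from `0`, then so is the self-convolution of `A`. -/
lemma exists_sum_mul_sub_eq_of_affine [Fintype V] [DecidableEq V] {z A : V → ℤ} {s e a : ℤ}
    (hA : ∀ x, s * A x = e - z x + if x = 0 then a else 0)
    (hz : ∃ c k : ℤ, ∀ v, ∑ x, z x * z (v - x) = c + k * z v) :
    ∃ c k : ℤ, ∀ v, v ≠ 0 → s ^ 2 * ∑ x, A x * A (v - x) = c + k * z v := by
  obtain ⟨c, k, hck⟩ := hz
  refine ⟨c + Fintype.card V * e ^ 2 - 2 * e * ∑ x, z x + 2 * e * a, k - 2 * a,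
    fun v hv ↦ ?_⟩
  have hrefl : ∑ x, z (v - x) = ∑ x, z x := Equiv.sum_comp (Equiv.subLeft v) z
  have hterm (x : V) : s ^ 2 * (A x * A (v - x)) =
      z x * z (v - x) + e ^ 2 - e * z x - e * z (v - x)
        + (if x = 0 then a * (e - z v) else 0) + (if x = v then a * (e - z v) else 0) := by
    have h1 := hA x
    have h2 := hA (v - x)
    rw [show s ^ 2 * (A x * A (v - x)) = (s * A x) * (s * A (v - x)) by ring, h1, h2]
    by_cases hx : x = 0
    · subst hx
      simp [hv, hv.symm]
      ring
    · by_cases hxv : x = v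
      · subst hxv
        simp [hv]
        ring
      · simp [hx, hxv, sub_eq_zero, Ne.symm hxv]
        ring
  rw [Finset.mul_sum, Finset.sum_congr rfl fun x _ ↦ hterm x]
  simp only [Finset.sum_add_distrib, Finset.sum_sub_distrib, ← Finset.mul_sum, hrefl, hck,
    Finset.sum_const, Finset.sum_ite_eq', Finset.mem_univ, if_true, Finset.card_univ,
    nsmul_eq_mul]
  ring

end ZeroCount

open scoped Classical in
theorem two_weight_code_graph_is_strongly_regular
    (F : Type*) [Field F] [Fintype F] (n w₁ w₂ : ℕ) (hww : w₁ ≠ w₂)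
    (C : Submodule F (Fin n → F))
    (φ : Fin n → (↥C →ₗ[F] F)) (hφ : ∀ i (c : C), φ i c = (c : Fin n → F) i)
    (hnz : ∀ i, φ i ≠ 0)
    (hpair : ∀ i j, i ≠ j → LinearIndependent F ![φ i, φ j])
    (hw : ∀ c : C, c ≠ 0 →
      hammingNorm (c : Fin n → F) = w₁ ∨ hammingNorm (c : Fin n → F) = w₂)
    (hocc₁ : ∃ c : C, c ≠ 0 ∧ hammingNorm (c : Fin n → F) = w₁)
    (hocc₂ : ∃ c : C, c ≠ 0 ∧ hammingNorm (c : Fin n → F) = w₂)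
    (G : SimpleGraph ↥C)
    (hG : ∀ u v : C, G.Adj u v ↔ u ≠ v ∧
      hammingNorm ((u : Fin n → F) - (v : Fin n → F)) = w₁) :
    ∃ d lam mu : ℕ, G.IsSRGWith (Fintype.card ↥C) d lam mu := by
  have hw₁ : w₁ ≠ 0 := by
    obtain ⟨c, hc, rfl⟩ := hocc₁
    simpa using hc
  let A : C → ℤ := fun x ↦ if hammingNorm (x : Fin n → F) = w₁ then 1 else 0
  have hzero (x : C) : zeroCount φ x = n - hammingNorm (x : Fin n → F) := by
    have h := Finset.card_filter_add_card_filter_not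
      (s := (Finset.univ : Finset (Fin n))) (fun i ↦ (x : Fin n → F) i = 0)
    simp only [zeroCount, hφ, hammingNorm, Finset.sum_boole]
    simp only [Finset.card_univ, Fintype.card_fin] at h
    push_cast [← h]
    simp
  have hA (x : C) : ((w₁ : ℤ) - w₂) * A x =
      (n - w₂) - zeroCount φ x + if x = 0 then (w₂ : ℤ) else 0 := by
    rw [hzero]
    by_cases hx : x = 0
    · subst hx
      simp [A, hw₁.symm]
    · rcases hw x hx with h | h
      · simp [A, h, hx]
      · simp [A, h, hx, hww.symm]
  have hadj (u v : C) : G.Adj u v ↔ hammingNorm ((u - v : C) : Fin n → F) = w₁ := by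
    rw [hG, Submodule.coe_sub, and_iff_right_iff_imp]
    rintro h rfl
    exact hw₁ (by simpa using h.symm)
  have hcommon (u v : C) : (Fintype.card (G.commonNeighbors u v) : ℤ) =
      ∑ x, A x * A (u - v - x) := by
    rw [← Equiv.sum_comp (Equiv.subLeft u), ← Set.toFinset_card]
    have hs : (G.commonNeighbors u v).toFinset = Finset.univ.filter fun x : C ↦
        hammingNorm ((u - x : C) : Fin n → F) = w₁ ∧
          hammingNorm ((x - v : C) : Fin n → F) = w₁ := by
      ext x
      simp only [Set.mem_toFinset, SimpleGraph.mem_commonNeighbors, ← hadj, G.adj_comm v x,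
        Finset.mem_filter, Finset.mem_univ, true_and]
    rw [hs, ← Finset.sum_boole]
    refine Finset.sum_congr rfl fun x _ ↦ ?_
    simp only [A, Equiv.subLeft_apply, sub_right_comm u v,
      sub_sub_cancel, ite_and, ite_mul, one_mul, zero_mul]
  obtain ⟨c, k, hck⟩ := exists_sum_mul_sub_eq_of_affine hA
    (exists_sum_zeroCount_mul_zeroCount_sub φ hnz hpair)
  have hconst (u v u' v' : C) (huv : u ≠ v) (huv' : u' ≠ v')
      (h : hammingNorm ((u - v : C) : Fin n → F) = hammingNorm ((u' - v' : C) : Fin n → F)) :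
      Fintype.card (G.commonNeighbors u v) = Fintype.card (G.commonNeighbors u' v') := by
    have hs : ((w₁ : ℤ) - w₂) ^ 2 ≠ 0 := by
      simpa [sub_eq_zero] using hww
    have hz : zeroCount φ (u - v) = zeroCount φ (u' - v') := by rw [hzero, hzero, h]
    zify
    rw [hcommon, hcommon]
    refine mul_left_cancel₀ hs ?_
    rw [hck _ (sub_ne_zero.2 huv), hck _ (sub_ne_zero.2 huv'), hz]
  obtain ⟨c₁, hc₁, h₁⟩ := hocc₁
  obtain ⟨c₂, hc₂, h₂⟩ := hocc₂
  refine ⟨G.degree 0, Fintype.card (G.commonNeighbors c₁ 0),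
    Fintype.card (G.commonNeighbors c₂ 0), rfl, fun v ↦ ?_, fun u v huv ↦ ?_,
    fun u v hne huv ↦ ?_⟩
  · rw [← G.card_neighborSet_eq_degree, ← G.card_neighborSet_eq_degree]
    refine Fintype.card_congr ((Equiv.subRight v).subtypeEquiv fun x ↦ ?_)
    simp only [SimpleGraph.mem_neighborSet, hadj, Equiv.subRight_apply, zero_sub, neg_sub]
  · exact hconst _ _ _ _ huv.ne hc₁ (by rw [(hadj u v).1 huv, sub_zero, h₁])
  · have h := (hw (u - v) (sub_ne_zero.2 hne)).resolve_left fun h ↦ huv ((hadj u v).2 h)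
    exact hconst _ _ _ _ hne hc₂ (by rw [h, sub_zero, h₂])
end

section
/- There exists a set K of 56 points of the projective space PG(5, 3) such that: (i) no three distinct points of K are collinear (i.e., representative vectors of any three distinct points of K are linearly independent in F_3^6); and (ii) every hyperplane of PG(5, 3) contains exactly 11 or exactly 20 points of K. (This is Hill's 56-cap, a two-intersection set with parameters (56, 6, 11, 20).) -/
/-- The ten blocks of a `2-(6, 3, 2)` design on `Fin 6`. -/
def hillBlocks : List (Fin 6 × Fin 6 × Fin 6) :=
  [(0, 1, 2), (0, 1, 3), (0, 2, 4), (0, 3, 5), (0, 4, 5),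
   (1, 2, 5), (1, 3, 4), (1, 4, 5), (2, 3, 4), (2, 3, 5)]

/-- Normalised representatives of the points of the Hill cap: the vectors of weight three supported
on a block of the design, and the vectors of weight six whose coordinates have product `1`. -/
def hillVectors : List (Fin 6 → ZMod 3) :=
  (hillBlocks.flatMap fun b => [1, -1].flatMap fun s => [1, -1].map fun t =>
    fun l => if l = b.1 then 1 else if l = b.2.1 then s else if l = b.2.2 then t else 0) ++
  [1, -1].flatMap fun a => [1, -1].flatMap fun b => [1, -1].flatMap fun c => [1, -1].map fun d =>
    ![1, a, b, c, d, a * b * c * d]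

lemma hillVectors_nodup : hillVectors.Nodup := by
  decide +kernel

lemma ne_neg_of_mem_hillVectors : ∀ v ∈ hillVectors, ∀ w ∈ hillVectors, v ≠ -w := by
  have h : hillVectors.all fun v => hillVectors.all fun w => v ≠ -w := by decide +kernel
  simpa only [List.all_eq_true, decide_eq_true_eq] using h

lemma ne_zero_of_mem_hillVectors {v : Fin 6 → ZMod 3} (hv : v ∈ hillVectors) : v ≠ 0 := by
  rintro rfl
  exact ne_neg_of_mem_hillVectors 0 hv 0 hv neg_zero.symm

lemma dotProduct_self_of_mem_hillVectors : ∀ v ∈ hillVectors, v ⬝ᵥ v = 0 := by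
  have h : hillVectors.all fun v => v ⬝ᵥ v = 0 := by decide +kernel
  simpa only [List.all_eq_true, decide_eq_true_eq] using h

/-- Orthogonality is a triangle-free graph on the Hill cap. -/
lemma not_pairwise_orthogonal : ∀ u ∈ hillVectors, ∀ v ∈ hillVectors, u ⬝ᵥ v ≠ 0 ∨ u = v ∨
    ∀ w ∈ hillVectors, u ⬝ᵥ w ≠ 0 ∨ u = w ∨ v ⬝ᵥ w ≠ 0 ∨ v = w := by
  have h : hillVectors.all fun u => hillVectors.all fun v => u ⬝ᵥ v ≠ 0 ∨ u = v ∨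
      hillVectors.all fun w => u ⬝ᵥ w ≠ 0 ∨ u = w ∨ v ⬝ᵥ w ≠ 0 ∨ v = w := by
    decide +kernel
  simpa only [List.all_eq_true, decide_eq_true_eq] using h

lemma countP_hillVectors : ∀ a b c d e f : ZMod 3,
    ¬(a = 0 ∧ b = 0 ∧ c = 0 ∧ d = 0 ∧ e = 0 ∧ f = 0) →
    hillVectors.countP (fun v =>
      v 0 * a + v 1 * b + v 2 * c + v 3 * d + v 4 * e + v 5 * f = 0) = 11 ∨
    hillVectors.countP (fun v =>
      v 0 * a + v 1 * b + v 2 * c + v 3 * d + v 4 * e + v 5 * f = 0) = 20 := by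
  decide +kernel

lemma countP_apply_eq_zero_hillVectors (φ : (Fin 6 → ZMod 3) →ₗ[ZMod 3] ZMod 3) (hφ : φ ≠ 0) :
    hillVectors.countP (fun v => φ v = 0) = 11 ∨ hillVectors.countP (fun v => φ v = 0) = 20 := by
  obtain ⟨a, b, c, d, e, f, h⟩ : ∃ a b c d e f, ∀ v, φ v =
      v 0 * a + v 1 * b + v 2 * c + v 3 * d + v 4 * e + v 5 * f := by
    refine ⟨φ (Pi.single 0 1), φ (Pi.single 1 1), φ (Pi.single 2 1), φ (Pi.single 3 1),
      φ (Pi.single 4 1), φ (Pi.single 5 1), fun v => ?_⟩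
    conv_lhs => rw [pi_eq_sum_univ' v]
    simp [Fin.sum_univ_six]
  simp only [h]
  refine countP_hillVectors a b c d e f ?_
  rintro ⟨rfl, rfl, rfl, rfl, rfl, rfl⟩
  exact hφ (LinearMap.ext fun v => by simp [h])

/-- In characteristic other than two, three pairwise independent isotropic vectors that are not
all pairwise orthogonal are linearly independent. -/
lemma linearIndependent_of_isotropic {F ι : Type*} [Field F] [Fintype ι] {u v w : ι → F}
    (htwo : (2 : F) ≠ 0)
    (huu : u ⬝ᵥ u = 0) (hvv : v ⬝ᵥ v = 0) (hww : w ⬝ᵥ w = 0)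
    (huv : LinearIndependent F ![u, v]) (huw : LinearIndependent F ![u, w])
    (hvw : LinearIndependent F ![v, w]) (h : ¬(u ⬝ᵥ v = 0 ∧ u ⬝ᵥ w = 0 ∧ v ⬝ᵥ w = 0)) :
    LinearIndependent F ![u, v, w] := by
  rw [LinearIndependent.pair_iff] at huv huw hvw
  rw [Fintype.linearIndependent_iff]
  intro g hg
  simp only [Fin.sum_univ_three, Matrix.cons_val] at hg
  have hu := congrArg (u ⬝ᵥ ·) hg
  have hv := congrArg (v ⬝ᵥ ·) hg
  have hw := congrArg (w ⬝ᵥ ·) hg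
  simp only [dotProduct_add, dotProduct_smul, smul_eq_mul, huu, hvv, hww, mul_zero, zero_add,
    add_zero, dotProduct_zero, dotProduct_comm v u, dotProduct_comm w u, dotProduct_comm w v]
    at hu hv hw
  suffices g 0 = 0 ∨ g 1 = 0 ∨ g 2 = 0 by
    suffices g 0 = 0 ∧ g 1 = 0 ∧ g 2 = 0 by
      simpa [Fin.forall_fin_succ] using this
    rcases this with h0 | h1 | h2
    · have := hvw (g 1) (g 2) (by simpa [h0] using hg)
      exact ⟨h0, this⟩
    · have := huw (g 0) (g 2) (by simpa [h1] using hg)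
      exact ⟨this.1, h1, this.2⟩
    · have := huv (g 0) (g 1) (by simpa [h2] using hg)
      exact ⟨this.1, this.2, h2⟩
  by_contra! hne
  obtain ⟨h0, h1, h2⟩ := hne
  have hz : v ⬝ᵥ w = 0 := by
    have : 2 * g 1 * g 2 * v ⬝ᵥ w = 0 := by
      linear_combination g 1 * hv + g 2 * hw - g 0 * hu
    simpa [htwo, h1, h2] using this
  exact h ⟨by simpa [hz, h0] using hv, by simpa [hz, h0] using hw, hz⟩

/-- The point of the Hill cap represented by a vector of `hillVectors`. -/
def hillPoint (v : {v // v ∈ hillVectors}) : Projectivization (ZMod 3) (Fin 6 → ZMod 3) :=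
  .mk (ZMod 3) v.1 (ne_zero_of_mem_hillVectors v.2)

lemma hillPoint_rep (v : {v // v ∈ hillVectors}) :
    ∃ a : (ZMod 3)ˣ, a • v.1 = (hillPoint v).rep :=
  Projectivization.exists_smul_eq_mk_rep ..

lemma hillPoint_injective : Function.Injective hillPoint := by
  intro v w h
  obtain ⟨a, ha⟩ := (Projectivization.mk_eq_mk_iff ..).1 h
  have : a = 1 ∨ a = -1 := by clear ha; decide +revert
  rcases this with rfl | rfl
  · exact Subtype.ext (by simpa using ha.symm)
  · exact absurd (by simpa using ha.symm) (ne_neg_of_mem_hillVectors _ v.2 _ w.2)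

lemma ncard_hillPoint_image (p : (Fin 6 → ZMod 3) → Prop) [DecidablePred p] :
    (hillPoint '' {v | p v.1}).ncard = hillVectors.countP p := by
  rw [Set.ncard_image_of_injective _ hillPoint_injective,
    ← Set.ncard_image_of_injective _ Subtype.val_injective, List.countP_eq_length_filter,
    ← List.toFinset_card_of_nodup (hillVectors_nodup.filter _), ← Set.ncard_coe_finset]
  congr 1
  ext v
  simp [and_comm]


theorem hill_cap_exists :
    ∃ K : Set (Projectivization (ZMod 3) (Fin 6 → ZMod 3)),
      K.ncard = 56 ∧
      (∀ P Q R, P ∈ K → Q ∈ K → R ∈ K → P ≠ Q → P ≠ R → Q ≠ R →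
        LinearIndependent (ZMod 3) ![P.rep, Q.rep, R.rep]) ∧
      (∀ φ : (Fin 6 → ZMod 3) →ₗ[ZMod 3] ZMod 3, φ ≠ 0 →
        {P ∈ K | φ P.rep = 0}.ncard = 11 ∨ {P ∈ K | φ P.rep = 0}.ncard = 20) := by
  refine ⟨Set.range hillPoint, ?_, ?_, fun φ hφ => ?_⟩
  · rw [← Set.image_univ]
    exact (ncard_hillPoint_image fun _ => True).trans (by decide +kernel)
  · rintro _ _ _ ⟨u, rfl⟩ ⟨v, rfl⟩ ⟨w, rfl⟩ huv huw hvw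
    obtain ⟨a, ha⟩ := hillPoint_rep u
    obtain ⟨b, hb⟩ := hillPoint_rep v
    obtain ⟨c, hc⟩ := hillPoint_rep w
    apply linearIndependent_of_isotropic (by decide)
    · simp [← ha, dotProduct_self_of_mem_hillVectors u.1 u.2]
    · simp [← hb, dotProduct_self_of_mem_hillVectors v.1 v.2]
    · simp [← hc, dotProduct_self_of_mem_hillVectors w.1 w.2]
    · exact Projectivization.linearIndependent_pair_iff_ne.2 huv
    · exact Projectivization.linearIndependent_pair_iff_ne.2 huw
    · exact Projectivization.linearIndependent_pair_iff_ne.2 hvw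
    · have key := not_pairwise_orthogonal u.1 u.2 v.1 v.2
      have hne {x y : {v // v ∈ hillVectors}} (h : hillPoint x ≠ hillPoint y) : x.1 ≠ y.1 :=
        fun e => h (congrArg hillPoint (Subtype.ext e))
      simp only [← ha, ← hb, ← hc, smul_dotProduct, dotProduct_smul, smul_eq_zero_iff_eq]
      rintro ⟨h1, h2, h3⟩
      rcases key with h | h | h
      · exact h h1
      · exact hne huv h
      · rcases h w.1 w.2 with h | h | h | h
        exacts [h h2, hne huw h, h h3, hne hvw h]
  · have h : {P ∈ Set.range hillPoint | φ P.rep = 0} = hillPoint '' {v | φ v.1 = 0} := by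
      ext P
      constructor
      · rintro ⟨⟨v, rfl⟩, hv⟩
        obtain ⟨a, ha⟩ := hillPoint_rep v
        refine ⟨v, ?_, rfl⟩
        simpa [← ha, Units.smul_def] using hv
      · rintro ⟨v, hv, rfl⟩
        obtain ⟨a, ha⟩ := hillPoint_rep v
        refine ⟨⟨v, rfl⟩, ?_⟩
        simpa [← ha, Units.smul_def] using hv
    rw [h, ncard_hillPoint_image fun v => φ v = 0]
    exact countP_apply_eq_zero_hillVectors φ hφ
end
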